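/- Let k and l be positive integers. Then Σ_{M∈𝓜_{l,k}} (∏_{a,b=1}^{k} m_{a,b}!) · mul(M)² = (∏_{j=0}^{k+l-1} j!) / ((∏_{j=0}^{k-1} j!) · (∏_{j=0}^{l-1} j!)). -/

import Mathlib

open scoped BigOperators

/-- Matrices with all row sums and column sums equal to `l`. -/
def IsMagic (k l : ℕ) (M : Matrix (Fin k) (Fin k) ℕ) : Prop :=
  (∀ a, ∑ b, M a b = l) ∧ (∀ b, ∑ a, M a b = l)

/-- Permutation matrix `R(σ)` with natural number entries. -/
def permMat (k : ℕ) (σ : Equiv.Perm (Fin k)) : Matrix (Fin k) (Fin k) ℕ :=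
  Matrix.of fun a b => if σ a = b then 1 else 0

/-- Permutation matrix `R(σ)` with integer entries. -/
def permMatZ (k : ℕ) (σ : Equiv.Perm (Fin k)) : Matrix (Fin k) (Fin k) ℤ :=
  Matrix.of fun a b => if σ a = b then 1 else 0

/-- The determinant of the generic `k × k` matrix of indeterminates over `ℚ`. -/
noncomputable def detX (k : ℕ) : MvPolynomial (Fin k × Fin k) ℚ :=
  Matrix.det (Matrix.of fun a b : Fin k => MvPolynomial.X (a, b))

/-- `mul_l(M)`: the coefficient of the monomial `∏ x_{a,b}^{M a b}` in `det(X)^l`. -/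
noncomputable def mulCoeff (k l : ℕ) (M : Matrix (Fin k) (Fin k) ℕ) : ℚ :=
  MvPolynomial.coeff (Finsupp.equivFunOnFinite.symm fun p : Fin k × Fin k => M p.1 p.2)
    (detX k ^ l)

open Classical in
/-- `mul_l` extended to integer matrices: it is `0` when some entry is negative. -/
noncomputable def mulCoeffZ (k l : ℕ) (M : Matrix (Fin k) (Fin k) ℤ) : ℚ :=
  if ∀ a b, 0 ≤ M a b then mulCoeff k l (Matrix.of fun a b => (M a b).toNat) else 0

open MvPolynomial in
/-- The Fischer functional `f ↦ ∑_m m! f_m g_m` attached to a polynomial `g`. -/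
noncomputable def fischer {ι : Type*} [Fintype ι] (g : MvPolynomial ι ℚ) :
    MvPolynomial ι ℚ →ₗ[ℚ] ℚ :=
  (basisMonomials ι ℚ).constr ℚ fun m => (∏ i, ((m i).factorial : ℚ)) * coeff m g

section Fischer

open MvPolynomial

variable {ι : Type*} [Fintype ι]

lemma fischer_monomial (g : MvPolynomial ι ℚ) (m : ι →₀ ℕ) (a : ℚ) :
    fischer g (monomial m a) = a * ((∏ i, ((m i).factorial : ℚ)) * coeff m g) := by
  have h : (monomial m a : MvPolynomial ι ℚ) = a • basisMonomials ι ℚ m := by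
    simp [smul_monomial]
  rw [h, map_smul, fischer, Module.Basis.constr_basis, smul_eq_mul]

lemma fischer_apply (f g : MvPolynomial ι ℚ) :
    fischer g f = ∑ m ∈ f.support, (∏ i, ((m i).factorial : ℚ)) * (coeff m f * coeff m g) := by
  conv_lhs => rw [f.as_sum, map_sum]
  exact Finset.sum_congr rfl fun m _ => by rw [fischer_monomial]; ring

lemma fischer_sum_smul {κ : Type*} (s : Finset κ) (c : κ → ℚ) (G : κ → MvPolynomial ι ℚ)
    (f : MvPolynomial ι ℚ) :
    fischer (∑ x ∈ s, c x • G x) f = ∑ x ∈ s, c x * fischer (G x) f := by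
  simp only [fischer_apply, coeff_sum, coeff_smul, smul_eq_mul, Finset.mul_sum]
  rw [Finset.sum_comm]
  exact Finset.sum_congr rfl fun _ _ => Finset.sum_congr rfl fun _ _ => by ring

lemma fischer_smul (c : ℚ) (g f : MvPolynomial ι ℚ) :
    fischer (c • g) f = c * fischer g f := by
  simpa using fischer_sum_smul Finset.univ (fun _ : Unit => c) (fun _ => g) f

lemma fischer_X_mul (f g : MvPolynomial ι ℚ) (p : ι) :
    fischer g (X p * f) = fischer (pderiv p g) f := by
  classical
  induction f using MvPolynomial.induction_on' with
  | add f₁ f₂ h₁ h₂ => rw [mul_add, map_add, map_add, h₁, h₂]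
  | monomial m a =>
    rw [X, monomial_mul, one_mul, fischer_monomial, fischer_monomial, coeff_pderiv,
      ← Finset.mul_prod_erase _ _ (Finset.mem_univ p),
      ← Finset.mul_prod_erase _ (fun i => ((m i).factorial : ℚ)) (Finset.mem_univ p)]
    have h : ∏ i ∈ Finset.univ.erase p, (((Finsupp.single p 1 + m : ι →₀ ℕ) i).factorial : ℚ) =
        ∏ i ∈ Finset.univ.erase p, ((m i).factorial : ℚ) :=
      Finset.prod_congr rfl fun i hi => by
        simp [Finsupp.single_eq_of_ne (Finset.ne_of_mem_erase hi)]
    rw [h, add_comm (Finsupp.single p 1) m]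
    simp only [Finsupp.add_apply, Finsupp.single_eq_same, Nat.factorial_succ]
    push_cast
    ring

end Fischer

lemma Derivation.apply_prod {R A κ : Type*} [CommSemiring R] [CommSemiring A] [Algebra R A]
    [DecidableEq κ] (D : Derivation R A A) (s : Finset κ) (f : κ → A) :
    D (∏ i ∈ s, f i) = ∑ i ∈ s, (∏ j ∈ s.erase i, f j) * D (f i) := by
  induction s using Finset.induction_on with
  | empty => simp
  | insert a s ha ih =>
    rw [Finset.prod_insert ha, D.leibniz, ih, Finset.sum_insert ha, Finset.erase_insert ha,
      smul_eq_mul, smul_eq_mul, Finset.mul_sum, add_comm]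
    congr 1
    refine Finset.sum_congr rfl fun i hi => ?_
    have hai : a ≠ i := fun h => ha (h ▸ hi)
    rw [Finset.erase_insert_of_ne hai, Finset.prod_insert (fun h => ha (Finset.mem_of_mem_erase h)),
      mul_assoc]

section Cayley

open MvPolynomial

/-- The adjugate of the generic `k × k` matrix. -/
noncomputable def adjX (k : ℕ) : Matrix (Fin k) (Fin k) (MvPolynomial (Fin k × Fin k) ℚ) :=
  (Matrix.mvPolynomialX (Fin k) (Fin k) ℚ).adjugate

lemma detX_eq (k : ℕ) : detX k = (Matrix.mvPolynomialX (Fin k) (Fin k) ℚ).det := rfl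

lemma detX_ne_zero (k : ℕ) : detX k ≠ 0 := Matrix.det_mvPolynomialX_ne_zero (Fin k) ℚ

lemma detX_eq_sum (k : ℕ) :
    detX k = ∑ σ : Equiv.Perm (Fin k), ((σ.sign : ℤ) : ℚ) • ∏ r, X (σ r, r) := by
  rw [detX_eq, Matrix.det_apply']
  refine Finset.sum_congr rfl fun σ _ => ?_
  rw [MvPolynomial.smul_eq_C_mul]
  simp

lemma pderiv_detX (k : ℕ) (i j : Fin k) : pderiv (i, j) (detX k) = adjX k j i := by
  rw [adjX, ← Matrix.transpose_apply (Matrix.adjugate _), Matrix.adjugate_transpose,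
    Matrix.adjugate_apply, Matrix.updateRow_transpose, Matrix.det_transpose, Matrix.det_apply',
    detX_eq, Matrix.det_apply', map_sum]
  refine Finset.sum_congr rfl fun σ _ => ?_
  rw [← Finset.mul_prod_erase _ (fun x => Matrix.mvPolynomialX (Fin k) (Fin k) ℚ (σ x) x)
      (Finset.mem_univ j),
    ← Finset.mul_prod_erase _ (fun x =>
      (Matrix.mvPolynomialX (Fin k) (Fin k) ℚ).updateCol j (Pi.single i 1) (σ x) x)
      (Finset.mem_univ j)]
  simp only [Matrix.mvPolynomialX_apply]
  have h : ∏ x ∈ Finset.univ.erase j,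
      (Matrix.mvPolynomialX (Fin k) (Fin k) ℚ).updateCol j (Pi.single i 1) (σ x) x =
      ∏ x ∈ Finset.univ.erase j, X (σ x, x) :=
    Finset.prod_congr rfl fun x hx => by
      rw [Matrix.updateCol_ne (Finset.ne_of_mem_erase hx), Matrix.mvPolynomialX_apply]
  rw [h, Matrix.updateCol_self, Derivation.leibniz, Derivation.map_intCast, smul_zero, add_zero,
    smul_eq_mul, Derivation.leibniz, Derivation.apply_prod, Finset.sum_eq_zero, pderiv_X]
  · by_cases hij : σ j = i
    · subst hij; simp
    · have : (σ j, j) ≠ (i, j) := by simpa using hij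
      simp [hij, this]
  · intro b hb
    rw [pderiv_X_of_ne, mul_zero]
    simp [Finset.ne_of_mem_erase hb]

lemma detX_mul_pderiv_adjX (k : ℕ) (i j p q : Fin k) :
    detX k * pderiv (i, j) (adjX k p q) =
      adjX k j i * adjX k p q - adjX k p i * adjX k j q := by
  have hX : ∀ a b, ∑ c, (X (a, c) : MvPolynomial (Fin k × Fin k) ℚ) * adjX k c b =
      detX k * (1 : Matrix (Fin k) (Fin k) (MvPolynomial (Fin k × Fin k) ℚ)) a b := by
    intro a b
    have := congrFun (congrFun (Matrix.mul_adjugate (Matrix.mvPolynomialX (Fin k) (Fin k) ℚ)) a) b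
    simpa [Matrix.mul_apply, adjX, detX_eq] using this
  have hA : ∀ a b, ∑ c, adjX k a c * (X (c, b) : MvPolynomial (Fin k × Fin k) ℚ) =
      detX k * (1 : Matrix (Fin k) (Fin k) (MvPolynomial (Fin k × Fin k) ℚ)) a b := by
    intro a b
    have := congrFun (congrFun (Matrix.adjugate_mul (Matrix.mvPolynomialX (Fin k) (Fin k) ℚ)) a) b
    simpa [Matrix.mul_apply, adjX, detX_eq] using this
  have hD : ∀ a, ∑ c, X (a, c) * pderiv (i, j) (adjX k c q) =
      adjX k j i * (1 : Matrix (Fin k) (Fin k) (MvPolynomial (Fin k × Fin k) ℚ)) a q -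
        if a = i then adjX k j q else 0 := by
    intro a
    have h := congrArg (pderiv (i, j)) (hX a q)
    have h1 : pderiv (i, j) ((1 : Matrix (Fin k) (Fin k) (MvPolynomial (Fin k × Fin k) ℚ)) a q)
        = 0 := by
      rw [Matrix.one_apply]; split_ifs <;> simp
    have h2 : ∑ c, adjX k c q * pderiv (i, j) (X (a, c)) = if a = i then adjX k j q else 0 := by
      rw [Finset.sum_eq_single j]
      · rw [pderiv_X]
        by_cases hai : a = i
        · subst hai; simp
        · have : (a, j) ≠ (i, j) := by simpa using hai
          simp [hai, this]
      · intro c _ hc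
        rw [pderiv_X_of_ne (by simp [hc]), mul_zero]
      · simp
    simp only [map_sum, Derivation.leibniz, smul_eq_mul, h1, mul_zero, zero_add,
      Finset.sum_add_distrib, h2, pderiv_detX] at h
    rw [mul_comm (adjX k j i), ← h]; ring
  calc detX k * pderiv (i, j) (adjX k p q)
      = ∑ c, (detX k * (1 : Matrix (Fin k) (Fin k) (MvPolynomial (Fin k × Fin k) ℚ)) p c) *
          pderiv (i, j) (adjX k c q) := by simp [Matrix.one_apply]
    _ = ∑ a, adjX k p a * ∑ c, X (a, c) * pderiv (i, j) (adjX k c q) := by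
        simp_rw [← hA, Finset.sum_mul, Finset.mul_sum]
        rw [Finset.sum_comm]
        simp only [mul_assoc]
    _ = _ := by
        simp [hD, mul_sub, Finset.sum_sub_distrib, Matrix.one_apply, mul_comm]

/-- The iterated derivative `∂_{σ(n-1),n-1} ⋯ ∂_{σ(0),0} det(X)^s`. -/
noncomputable def iterDeriv (k s : ℕ) (σ : Equiv.Perm (Fin k)) :
    ℕ → MvPolynomial (Fin k × Fin k) ℚ
  | 0 => detX k ^ s
  | n + 1 => if h : n < k then pderiv (σ ⟨n, h⟩, ⟨n, h⟩) (iterDeriv k s σ n)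
      else iterDeriv k s σ n

/-- The product of the entries `(r, σ r)` of the adjugate over `r < n`. -/
noncomputable def adjProd (k : ℕ) (σ : Equiv.Perm (Fin k)) (n : ℕ) :
    MvPolynomial (Fin k × Fin k) ℚ :=
  ∏ r with (r : Fin k).val < n, adjX k r (σ r)

lemma filter_val_lt_succ {k n : ℕ} (h : n < k) :
    (Finset.univ.filter fun r : Fin k => r.val < n + 1) =
      insert ⟨n, h⟩ (Finset.univ.filter fun r : Fin k => r.val < n) := by
  ext r
  simp [Fin.ext_iff]
  omega

lemma adjProd_succ {k n : ℕ} (h : n < k) (σ : Equiv.Perm (Fin k)) :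
    adjProd k σ (n + 1) = adjX k ⟨n, h⟩ (σ ⟨n, h⟩) * adjProd k σ n := by
  rw [adjProd, filter_val_lt_succ h, Finset.prod_insert (by simp), adjProd]

lemma card_filter_val_lt {k n : ℕ} (h : n ≤ k) :
    (Finset.univ.filter fun r : Fin k => r.val < n).card = n := by
  rw [Fin.card_filter_val_lt, min_eq_right h]

lemma detX_mul_pderiv_pow (k s : ℕ) (i j : Fin k) :
    detX k * pderiv (i, j) (detX k ^ s) = s * (adjX k j i * detX k ^ s) := by
  rw [pderiv_pow, pderiv_detX]
  cases s with
  | zero => simp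
  | succ s => rw [Nat.add_sub_cancel, pow_succ]; ring

lemma detX_mul_pderiv_adjProd {k n : ℕ} (h : n < k) (σ : Equiv.Perm (Fin k)) :
    detX k * pderiv (σ ⟨n, h⟩, ⟨n, h⟩) (adjProd k σ n) =
      n * adjProd k σ (n + 1) -
        ∑ r with (r : Fin k).val < n, adjProd k (σ * Equiv.swap r ⟨n, h⟩) (n + 1) := by
  have key : ∀ r ∈ Finset.univ.filter (fun r : Fin k => r.val < n),
      detX k * ((∏ j ∈ (Finset.univ.filter fun r : Fin k => r.val < n).erase r, adjX k j (σ j)) *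
        pderiv (σ ⟨n, h⟩, ⟨n, h⟩) (adjX k r (σ r))) =
      adjProd k σ (n + 1) - adjProd k (σ * Equiv.swap r ⟨n, h⟩) (n + 1) := by
    intro r hr
    have hrn : r.val < n := by simpa using hr
    rw [mul_left_comm, detX_mul_pderiv_adjX, adjProd_succ h, adjProd_succ h, adjProd, adjProd,
      ← Finset.mul_prod_erase _ _ hr,
      ← Finset.mul_prod_erase _ (fun j => adjX k j ((σ * Equiv.swap r ⟨n, h⟩) j)) hr]
    have : ∏ j ∈ (Finset.univ.filter fun r : Fin k => r.val < n).erase r,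
        adjX k j ((σ * Equiv.swap r ⟨n, h⟩) j) =
        ∏ j ∈ (Finset.univ.filter fun r : Fin k => r.val < n).erase r, adjX k j (σ j) := by
      refine Finset.prod_congr rfl fun j hj => ?_
      simp only [Finset.mem_erase, Finset.mem_filter, Finset.mem_univ, true_and] at hj
      rw [Equiv.Perm.mul_apply, Equiv.swap_apply_of_ne_of_ne hj.1]
      rintro rfl
      exact lt_irrefl _ hj.2
    rw [this]
    simp only [Equiv.Perm.mul_apply, Equiv.swap_apply_left, Equiv.swap_apply_right]
    ring
  rw [adjProd, Derivation.apply_prod, Finset.mul_sum, Finset.sum_congr rfl key,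
    Finset.sum_sub_distrib, Finset.sum_const, card_filter_val_lt h.le, nsmul_eq_mul]

lemma sum_sign_smul_iterDeriv (k s n : ℕ) (hn : n ≤ k) (g : Equiv.Perm (Fin k) → ℚ)
    (hg : ∀ σ, ∀ a b : Fin k, a.val < n → b.val < n → g (σ * Equiv.swap a b) = g σ) :
    ∑ σ : Equiv.Perm (Fin k), (((σ.sign : ℤ) : ℚ) * g σ) • (detX k ^ n * iterDeriv k s σ n) =
      ∑ σ : Equiv.Perm (Fin k), (((σ.sign : ℤ) : ℚ) * g σ) •
        ((∏ i ∈ Finset.range n, ((s : ℚ) + i)) • (detX k ^ s * adjProd k σ n)) := by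
  induction n generalizing g with
  | zero => simp [iterDeriv, adjProd]
  | succ n ih =>
    have h : n < k := hn
    set N : Fin k := ⟨n, h⟩ with hN
    set c : ℚ := ∏ i ∈ Finset.range n, ((s : ℚ) + i) with hc
    have transfer : ∀ L : Fin k → MvPolynomial (Fin k × Fin k) ℚ →ₗ[ℚ]
        MvPolynomial (Fin k × Fin k) ℚ,
        ∑ σ : Equiv.Perm (Fin k), (((σ.sign : ℤ) : ℚ) * g σ) •
          L (σ N) (detX k ^ n * iterDeriv k s σ n) =
        ∑ σ : Equiv.Perm (Fin k), (((σ.sign : ℤ) : ℚ) * g σ) •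
          (c • L (σ N) (detX k ^ s * adjProd k σ n)) := by
      intro L
      have hsplit : ∀ F : Equiv.Perm (Fin k) → MvPolynomial (Fin k × Fin k) ℚ,
          ∑ σ : Equiv.Perm (Fin k), (((σ.sign : ℤ) : ℚ) * g σ) • L (σ N) (F σ) =
          ∑ d, L d (∑ σ : Equiv.Perm (Fin k),
            (((σ.sign : ℤ) : ℚ) * (g σ * if σ N = d then 1 else 0)) • F σ) := by
        intro F
        simp only [map_sum, map_smul]
        rw [Finset.sum_comm]
        refine Finset.sum_congr rfl fun σ _ => ?_
        rw [Finset.sum_eq_single (σ N)]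
        · simp
        · intro d _ hd; simp [hd.symm]
        · simp
      rw [hsplit, show (∑ σ : Equiv.Perm (Fin k), (((σ.sign : ℤ) : ℚ) * g σ) •
          c • L (σ N) (detX k ^ s * adjProd k σ n)) = ∑ σ : Equiv.Perm (Fin k),
          (((σ.sign : ℤ) : ℚ) * g σ) • L (σ N) (c • (detX k ^ s * adjProd k σ n)) by
        simp only [map_smul], hsplit]
      refine Finset.sum_congr rfl fun d _ => congrArg _ (ih h.le _ ?_)
      intro σ a b ha hb
      rw [hg σ a b (by omega) (by omega), Equiv.Perm.mul_apply, Equiv.swap_apply_of_ne_of_ne]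
      · rintro rfl; exact lt_irrefl _ ha
      · rintro rfl; exact lt_irrefl _ hb
    have hder : ∑ σ : Equiv.Perm (Fin k), (((σ.sign : ℤ) : ℚ) * g σ) •
          (detX k * pderiv (σ N, N) (detX k ^ n * iterDeriv k s σ n)) =
        ∑ σ : Equiv.Perm (Fin k), (((σ.sign : ℤ) : ℚ) * g σ) •
          (c • (detX k * pderiv (σ N, N) (detX k ^ s * adjProd k σ n))) := by
      have := transfer fun d => (LinearMap.mulLeft ℚ (detX k)).comp
        ((pderiv (d, N) : Derivation ℚ (MvPolynomial (Fin k × Fin k) ℚ)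
          (MvPolynomial (Fin k × Fin k) ℚ)) : _ →ₗ[ℚ] _)
      simpa only [LinearMap.comp_apply, LinearMap.mulLeft_apply, Derivation.coeFn_coe] using this
    have hmul : ∑ σ : Equiv.Perm (Fin k), (((σ.sign : ℤ) : ℚ) * g σ) •
          (adjX k N (σ N) * (detX k ^ n * iterDeriv k s σ n)) =
        ∑ σ : Equiv.Perm (Fin k), (((σ.sign : ℤ) : ℚ) * g σ) •
          (c • (adjX k N (σ N) * (detX k ^ s * adjProd k σ n))) :=
      transfer fun d => LinearMap.mulLeft ℚ (adjX k N d)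
    have hL : ∀ σ : Equiv.Perm (Fin k),
        detX k * pderiv (σ N, N) (detX k ^ n * iterDeriv k s σ n) =
        detX k ^ (n + 1) * iterDeriv k s σ (n + 1) +
          (n : ℚ) • (adjX k N (σ N) * (detX k ^ n * iterDeriv k s σ n)) := by
      intro σ
      have h1 := detX_mul_pderiv_pow k n (σ N) N
      have h2 : iterDeriv k s σ (n + 1) = pderiv (σ N, N) (iterDeriv k s σ n) := by
        rw [iterDeriv, dif_pos h]
      rw [Derivation.leibniz, h2, MvPolynomial.smul_eq_C_mul, smul_eq_mul, smul_eq_mul, map_natCast]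
      linear_combination iterDeriv k s σ n * h1
    have hR : ∀ σ : Equiv.Perm (Fin k),
        detX k * pderiv (σ N, N) (detX k ^ s * adjProd k σ n) =
        ((s : ℚ) + n) • (detX k ^ s * adjProd k σ (n + 1)) -
          ∑ r with (r : Fin k).val < n,
            detX k ^ s * adjProd k (σ * Equiv.swap r N) (n + 1) := by
      intro σ
      have h1 := detX_mul_pderiv_pow k s (σ N) N
      have h2 := detX_mul_pderiv_adjProd h σ
      have h3 := adjProd_succ h σ
      rw [← hN] at h2 h3
      rw [Derivation.leibniz, MvPolynomial.smul_eq_C_mul, smul_eq_mul, smul_eq_mul, map_add,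
        map_natCast, map_natCast, ← Finset.mul_sum]
      linear_combination adjProd k σ n * h1 + detX k ^ s * h2 - s * detX k ^ s * h3
    have hswap : ∀ r ∈ Finset.univ.filter (fun r : Fin k => r.val < n),
        ∑ σ : Equiv.Perm (Fin k), (((σ.sign : ℤ) : ℚ) * g σ) •
          (detX k ^ s * adjProd k (σ * Equiv.swap r N) (n + 1)) =
        -∑ σ : Equiv.Perm (Fin k), (((σ.sign : ℤ) : ℚ) * g σ) •
          (detX k ^ s * adjProd k σ (n + 1)) := by
      intro r hr
      have hrn : r.val < n := by simpa using hr
      have hne : r ≠ N := by rintro rfl; exact lt_irrefl _ hrn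
      rw [← Finset.sum_neg_distrib]
      refine Fintype.sum_equiv (Equiv.mulRight (Equiv.swap r N)) _ _ fun σ => ?_
      rw [Equiv.coe_mulRight, hg σ r N (by omega) (by simp [hN]), Equiv.Perm.sign_mul,
        Equiv.Perm.sign_swap hne]
      simp
    have hR' : ∑ σ : Equiv.Perm (Fin k), (((σ.sign : ℤ) : ℚ) * g σ) •
          (∑ r with (r : Fin k).val < n,
            detX k ^ s * adjProd k (σ * Equiv.swap r N) (n + 1)) =
        -((n : ℚ) • ∑ σ : Equiv.Perm (Fin k), (((σ.sign : ℤ) : ℚ) * g σ) •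
          (detX k ^ s * adjProd k σ (n + 1))) := by
      simp only [Finset.smul_sum (s := Finset.univ.filter _)]
      rw [Finset.sum_comm, Finset.sum_congr rfl hswap, Finset.sum_const,
        card_filter_val_lt h.le, ← Nat.cast_smul_eq_nsmul ℚ, smul_neg]
    have hM : ∀ σ : Equiv.Perm (Fin k), adjX k N (σ N) * (detX k ^ s * adjProd k σ n) =
        detX k ^ s * adjProd k σ (n + 1) := by
      intro σ
      rw [adjProd_succ h σ, ← hN]; ring
    have hcomm : ∀ (a : ℚ) (F : Equiv.Perm (Fin k) → MvPolynomial (Fin k × Fin k) ℚ),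
        ∑ σ : Equiv.Perm (Fin k), (((σ.sign : ℤ) : ℚ) * g σ) • (a • F σ) =
        a • ∑ σ : Equiv.Perm (Fin k), (((σ.sign : ℤ) : ℚ) * g σ) • F σ := by
      intro a F
      rw [Finset.smul_sum]
      exact Finset.sum_congr rfl fun σ _ => smul_comm _ _ _
    simp only [hL, hR, hM, hcomm] at hder hmul
    simp only [smul_add, smul_sub, Finset.sum_add_distrib, Finset.sum_sub_distrib, hcomm, hmul,
      hR'] at hder
    rw [Finset.prod_range_succ, ← hc, hcomm, eq_sub_of_add_eq hder]
    module

/-- The Cayley identity `det(∂) det(X)^(s+1) = (s+1)(s+2)⋯(s+k) det(X)^s`. -/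
lemma cayley_identity (k s : ℕ) (hk : 0 < k) :
    ∑ σ : Equiv.Perm (Fin k), ((σ.sign : ℤ) : ℚ) • iterDeriv k (s + 1) σ k =
      (∏ i ∈ Finset.range k, (((s + 1 : ℕ) : ℚ) + i)) • detX k ^ s := by
  have h := sum_sign_smul_iterDeriv k (s + 1) k le_rfl (fun _ => 1) (by simp)
  have hdet : ∑ σ : Equiv.Perm (Fin k), ((σ.sign : ℤ) : ℚ) • adjProd k σ k =
      detX k ^ (k - 1) := by
    have : (adjX k).transpose.det = detX k ^ (k - 1) := by
      rw [Matrix.det_transpose, adjX, Matrix.det_adjugate, Fintype.card_fin, detX_eq]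
    rw [← this, Matrix.det_apply']
    refine Finset.sum_congr rfl fun σ _ => ?_
    rw [MvPolynomial.smul_eq_C_mul]
    simp [adjProd]
  apply mul_left_cancel₀ (pow_ne_zero k (detX_ne_zero k))
  simp only [mul_one, smul_comm _ (∏ i ∈ Finset.range k, _), ← mul_smul_comm, ← Finset.mul_sum,
    ← Finset.smul_sum, hdet] at h
  rw [h, mul_smul_comm, mul_smul_comm, ← pow_add, ← pow_add]
  congr 2
  omega

lemma fischer_prod_X_mul (k s n : ℕ) (hn : n ≤ k) (σ : Equiv.Perm (Fin k))
    (f : MvPolynomial (Fin k × Fin k) ℚ) :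
    fischer (detX k ^ s) ((∏ r with (r : Fin k).val < n, X (σ r, r)) * f) =
      fischer (iterDeriv k s σ n) f := by
  induction n generalizing f with
  | zero => simp [iterDeriv]
  | succ n ih =>
    have h : n < k := hn
    rw [filter_val_lt_succ h, Finset.prod_insert (by simp), mul_assoc, mul_left_comm,
      ih h.le, fischer_X_mul, iterDeriv, dif_pos h]

lemma fischer_detX_pow_succ (k l : ℕ) (hk : 0 < k) :
    fischer (detX k ^ (l + 1)) (detX k ^ (l + 1)) =
      (∏ i ∈ Finset.range k, (((l + 1 : ℕ) : ℚ) + i)) * fischer (detX k ^ l) (detX k ^ l) := by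
  rw [← fischer_smul, ← cayley_identity k l hk, fischer_sum_smul]
  have h : detX k ^ (l + 1) = ∑ σ : Equiv.Perm (Fin k),
      ((σ.sign : ℤ) : ℚ) • ((∏ r with (r : Fin k).val < k, X (σ r, r)) * detX k ^ l) := by
    rw [pow_succ']
    nth_rewrite 1 [detX_eq_sum]
    simp [Finset.sum_mul]
  refine (congrArg (fischer (detX k ^ (l + 1))) h).trans ?_
  rw [map_sum]
  exact Finset.sum_congr rfl fun σ _ => by
    rw [map_smul, fischer_prod_X_mul k (l + 1) k le_rfl, smul_eq_mul]

lemma fischer_detX_pow (k l : ℕ) (hk : 0 < k) :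
    fischer (detX k ^ l) (detX k ^ l) =
      (∏ j ∈ Finset.range (k + l), (j.factorial : ℚ)) /
        ((∏ j ∈ Finset.range k, (j.factorial : ℚ)) *
          ∏ j ∈ Finset.range l, (j.factorial : ℚ)) := by
  have hne : ∀ n, (∏ j ∈ Finset.range n, (j.factorial : ℚ)) ≠ 0 := fun n =>
    Finset.prod_ne_zero_iff.2 fun j _ => by positivity
  rw [eq_div_iff (mul_ne_zero (hne k) (hne l))]
  induction l with
  | zero =>
    have : fischer (1 : MvPolynomial (Fin k × Fin k) ℚ) 1 = 1 := by
      rw [← C_1, C_apply, fischer_monomial]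
      simp
    simp [this]
  | succ l ih =>
    have hf : ((k + l).factorial : ℚ) =
        l.factorial * ∏ i ∈ Finset.range k, (((l + 1 : ℕ) : ℚ) + i) := by
      rw [add_comm k l, ← Nat.factorial_mul_ascFactorial, Nat.ascFactorial_eq_prod_range]
      push_cast
      rfl
    rw [fischer_detX_pow_succ k l hk, Finset.prod_range_succ _ l, ← add_assoc,
      Finset.prod_range_succ _ (k + l), hf, ← ih]
    ring

lemma isWeightedHomogeneous_detX (k : ℕ) (w : Fin k × Fin k → ℕ)
    (hw : ∀ σ : Equiv.Perm (Fin k), ∑ r, w (σ r, r) = 1) :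
    IsWeightedHomogeneous w (detX k) 1 := by
  rw [detX_eq_sum]
  refine IsWeightedHomogeneous.sum _ _ _ fun σ _ => ?_
  rw [MvPolynomial.smul_eq_C_mul, ← zero_add 1]
  refine (isWeightedHomogeneous_C w _).mul ?_
  rw [← hw σ]
  exact IsWeightedHomogeneous.prod _ _ _ fun r _ => isWeightedHomogeneous_X ℚ w (σ r, r)

lemma weight_eq_of_mulCoeff_ne_zero {k l : ℕ} {M : Matrix (Fin k) (Fin k) ℕ}
    (hM : mulCoeff k l M ≠ 0) (w : Fin k × Fin k → ℕ)
    (hw : ∀ σ : Equiv.Perm (Fin k), ∑ r, w (σ r, r) = 1) :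
    ∑ a, ∑ b, M a b * w (a, b) = l := by
  have h := (isWeightedHomogeneous_detX k w hw).pow l hM
  rw [Finsupp.weight_apply, Finsupp.sum_fintype _ _ (by simp), Fintype.sum_prod_type] at h
  simpa using h

lemma isMagic_of_mulCoeff_ne_zero {k l : ℕ} {M : Matrix (Fin k) (Fin k) ℕ}
    (hM : mulCoeff k l M ≠ 0) : IsMagic k l M := by
  constructor
  · intro a
    rw [← weight_eq_of_mulCoeff_ne_zero hM (fun p => if p.1 = a then 1 else 0)
      fun σ => by simp [← Equiv.eq_symm_apply]]
    simp only [mul_ite, mul_one, mul_zero]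
    rw [Finset.sum_comm]
    simp
  · intro b
    rw [← weight_eq_of_mulCoeff_ne_zero hM (fun p => if p.2 = b then 1 else 0) (by simp)]
    simp

end Cayley
/-- `Σ_{M ∈ 𝓜_{l,k}} (∏_{a,b} m_{a,b}!) · mul(M)²
    = (∏_{j=0}^{k+l-1} j!) / ((∏_{j=0}^{k-1} j!) (∏_{j=0}^{l-1} j!))`. -/
theorem magic_sum_eq_factorial_ratio (k l : ℕ) (hk : 0 < k) (hl : 0 < l) :
    (∑ᶠ (M : Matrix (Fin k) (Fin k) ℕ) (_ : IsMagic k l M),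
      (∏ a, ∏ b, ((M a b).factorial : ℚ)) * (mulCoeff k l M) ^ 2) =
      (∏ j ∈ Finset.range (k + l), (j.factorial : ℚ)) /
        ((∏ j ∈ Finset.range k, (j.factorial : ℚ)) *
          ∏ j ∈ Finset.range l, (j.factorial : ℚ)) := by
  classical
  rw [← fischer_detX_pow k l hk, fischer_apply]
  let e : (Fin k × Fin k →₀ ℕ) ≃ Matrix (Fin k) (Fin k) ℕ :=
    Finsupp.equivFunOnFinite.trans (Equiv.curry _ _ _)
  have hcoeff : ∀ m, mulCoeff k l (e m) = MvPolynomial.coeff m (detX k ^ l) := fun m =>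
    congrArg (fun m => MvPolynomial.coeff m (detX k ^ l)) (by ext p; rfl)
  have hdrop : ∀ M : Matrix (Fin k) (Fin k) ℕ, (∑ᶠ (_ : IsMagic k l M),
      (∏ a, ∏ b, ((M a b).factorial : ℚ)) * (mulCoeff k l M) ^ 2) =
      (∏ a, ∏ b, ((M a b).factorial : ℚ)) * (mulCoeff k l M) ^ 2 := by
    intro M
    by_cases hM : IsMagic k l M
    · simp [hM]
    · simp [hM, of_not_not (mt isMagic_of_mulCoeff_ne_zero hM)]
  rw [finsum_congr hdrop, ← finsum_comp_equiv e,
    finsum_eq_sum_of_support_subset (s := (detX k ^ l).support)]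
  · refine Finset.sum_congr rfl fun m _ => ?_
    rw [hcoeff, Fintype.prod_prod_type, sq]
    rfl
  · intro m hm
    rw [Function.mem_support, hcoeff] at hm
    rw [Finset.mem_coe, MvPolynomial.mem_support_iff]
    intro h0
    simp [h0] at hm
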